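/- Let m and k be integers with k ≥ 2 and m large enough that the construction fits (m ≥ k + 4), and let l be an integer with 0 ≤ l ≤ m - 2 - k. Then n_m ≤ k·(m-2)^{m-3} + (m-2)^{k-2}·[(m-2)^{m-2-k} - (m-3)^{m-2-k}]·((m-k-2)^2 + l^2 + 2lk - l(m-2)). -/

import Mathlib

/-- A graph `G` is `k`-choosable if for every assignment of lists of `k` colors
to the vertices there is a proper coloring choosing each vertex's color from its list. -/
def Choosable {V : Type*} (G : SimpleGraph V) (k : ℕ) : Prop :=
  ∀ L : V → Finset ℕ, (∀ v, (L v).card = k) →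
    ∃ c : V → ℕ, (∀ v, c v ∈ L v) ∧ ∀ u w, G.Adj u w → c u ≠ c w

/-- The choice number of `G` is the least `k` such that `G` is `k`-choosable. -/
noncomputable def choiceNumber {V : Type*} (G : SimpleGraph V) : ℕ :=
  sInf {k | Choosable G k}

/-- `nm m` is the smallest integer `n` such that `ch (K_{m,n}) = m - 1`. -/
noncomputable def nm (m : ℕ) : ℕ :=
  sInf {n | choiceNumber (completeBipartiteGraph (Fin m) (Fin n)) = m - 1}


theorem Choosable.mono {V : Type*} {G : SimpleGraph V} {a b : ℕ} (h : Choosable G a)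
    (hab : a ≤ b) : Choosable G b := by
  intro L hL
  choose L' hsub hcard using fun v => Finset.exists_subset_card_eq (hab.trans (hL v).ge)
  obtain ⟨c, hc, hadj⟩ := h L' hcard
  exact ⟨c, fun v => hsub v (hc v), hadj⟩

theorem choosable_completeBipartiteGraph_fin_zero (m r : ℕ) (hr : 1 ≤ r) :
    Choosable (completeBipartiteGraph (Fin m) (Fin 0)) r := by
  intro L hL
  have hne : ∀ v, (L v).Nonempty := fun v => Finset.card_pos.mp (by rw [hL v]; exact hr)
  choose c hc using hne
  refine ⟨c, hc, ?_⟩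
  rintro (u | u) (w | w) h
  · simp at h
  · exact w.elim0
  · exact u.elim0
  · exact u.elim0

/-- Adding one vertex to the second part of a complete bipartite graph raises the number of
colors that suffices by at most one. -/
theorem Choosable.completeBipartiteGraph_succ {m n r : ℕ}
    (h : Choosable (completeBipartiteGraph (Fin m) (Fin n)) r) :
    Choosable (completeBipartiteGraph (Fin m) (Fin (n + 1))) (r + 1) := by
  intro L hL
  obtain ⟨x, hx⟩ : (L (Sum.inr (Fin.last n))).Nonempty :=
    Finset.card_pos.mp (by rw [hL]; omega)
  let emb : Fin m ⊕ Fin n → Fin m ⊕ Fin (n + 1) := Sum.map id Fin.castSucc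
  have hle : ∀ v, r ≤ ((L (emb v)).erase x).card := fun v => by
    have := Finset.pred_card_le_card_erase (s := L (emb v)) (a := x)
    rw [hL] at this
    omega
  choose L' hsub hcard using fun v => Finset.exists_subset_card_eq (hle v)
  obtain ⟨c, hc, hadj⟩ := h L' hcard
  have hmem : ∀ v, c v ≠ x ∧ c v ∈ L (emb v) := fun v => Finset.mem_erase.mp (hsub v (hc v))
  have key : ∀ (i : Fin m) (j : Fin (n + 1)),
      c (Sum.inl i) ≠ Fin.lastCases (motive := fun _ => ℕ) x (fun j => c (Sum.inr j)) j := by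
    intro i j
    induction j using Fin.lastCases with
    | last => simpa using (hmem (Sum.inl i)).1
    | cast j => simpa using hadj (Sum.inl i) (Sum.inr j) (by simp)
  refine ⟨Sum.elim (fun i => c (Sum.inl i))
    (Fin.lastCases (motive := fun _ => ℕ) x (fun j => c (Sum.inr j))), ?_, ?_⟩
  · rintro (i | j)
    · simpa [emb] using (hmem (Sum.inl i)).2
    · induction j using Fin.lastCases with
      | last => simpa using hx
      | cast j => simpa [emb] using (hmem (Sum.inr j)).2
  · rintro (u | u) (w | w) huw
    · simp at huw
    · exact key u w
    · exact (key w u).symm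
    · simp at huw

theorem choiceNumber_eq_succ {V : Type*} {G : SimpleGraph V} {r : ℕ}
    (h : Choosable G (r + 1)) (hn : ¬ Choosable G r) : choiceNumber G = r + 1 := by
  refine le_antisymm (Nat.sInf_le h) (le_csInf ⟨_, h⟩ fun b hb => ?_)
  by_contra hlt
  exact hn (Choosable.mono hb (by omega))

theorem nm_le_of_not_choosable {r n : ℕ} (hr : 1 ≤ r)
    (h : ¬ Choosable (completeBipartiteGraph (Fin (r + 2)) (Fin n)) r) : nm (r + 2) ≤ n := by
  classical
  let P : ℕ → Prop := fun n => ¬ Choosable (completeBipartiteGraph (Fin (r + 2)) (Fin n)) r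
  have hex : ∃ n, P n := ⟨n, h⟩
  refine le_trans (Nat.sInf_le ?_) (Nat.find_min' hex h)
  have hspec : P (Nat.find hex) := Nat.find_spec hex
  have hmin : ∀ p < Nat.find hex, ¬ P p := fun p hp => Nat.find_min hex hp
  generalize Nat.find hex = n₀ at hspec hmin
  cases n₀ with
  | zero => exact absurd (choosable_completeBipartiteGraph_fin_zero _ _ hr) hspec
  | succ p =>
    exact choiceNumber_eq_succ (not_not.mp (hmin p p.lt_succ_self)).completeBipartiteGraph_succ
      hspec

/-- If every transversal of the lists `L` contains one of the lists `B`, then `L` and `B` together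
admit no proper coloring of the complete bipartite graph. -/
theorem not_choosable_of_forall_transversal {A C ι : Type*} [Fintype A] [Fintype ι] [Countable C]
    {r : ℕ} (L : A → Finset C) (B : ι → Finset C) (hL : ∀ i, (L i).card = r)
    (hB : ∀ b, (B b).card = r)
    (h : ∀ a : A → C, (∀ i, a i ∈ L i) → ∃ b, ∀ x ∈ B b, ∃ i, a i = x) :
    ¬ Choosable
      (completeBipartiteGraph (Fin (Fintype.card A)) (Fin (Fintype.card ι))) r := by
  intro hch
  obtain ⟨f, hf⟩ := exists_injective_nat C
  obtain ⟨c, hc, hadj⟩ := hch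
    (Sum.elim (fun i => (L ((Fintype.equivFin A).symm i)).map ⟨f, hf⟩)
      (fun j => (B ((Fintype.equivFin ι).symm j)).map ⟨f, hf⟩))
    (by rintro (i | j) <;> simp [hL, hB])
  have hl : ∀ i : A, ∃ x ∈ L i, f x = c (Sum.inl (Fintype.equivFin A i)) := fun i => by
    simpa using hc (Sum.inl (Fintype.equivFin A i))
  choose a haL haf using hl
  obtain ⟨b, hb⟩ := h a haL
  obtain ⟨x, hxB, hxf⟩ : ∃ x ∈ B b, f x = c (Sum.inr (Fintype.equivFin ι b)) := by
    simpa using hc (Sum.inr (Fintype.equivFin ι b))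
  obtain ⟨i, rfl⟩ := hb x hxB
  exact hadj (Sum.inl (Fintype.equivFin A i)) (Sum.inr (Fintype.equivFin ι b)) (by simp)
    ((haf i).symm.trans hxf)

theorem card_exists_eq_zero (d r : ℕ) :
    Fintype.card {g : Fin d → Fin (r + 1) // ∃ i, g i = 0} = (r + 1) ^ d - r ^ d := by
  have h1 : Fintype.card {g : Fin d → Fin (r + 1) // ∀ i, g i ≠ 0} = r ^ d := by
    rw [Fintype.card_congr (Equiv.subtypePiEquivPi (p := fun (_ : Fin d) (x : Fin (r + 1)) =>
      x ≠ 0))]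
    simp [Fintype.card_subtype_compl]
  have h2 := Fintype.card_subtype_compl (fun g : Fin d → Fin (r + 1) => ∀ i, g i ≠ 0)
  rw [h1] at h2
  simpa using h2

namespace ListConstruction

variable (e l q r : ℕ)

/-- The colors: those common to the first three lists, those shared by the second and third list
only, those private to the second and to the third list, those of the later lists that meet the
first list, and those of the remaining lists. -/
inductive Color
  | common (i : Fin (e + 2))
  | shared (i : Fin l)
  | second (i : Fin q)
  | third (i : Fin q)
  | meeting (i : Fin (l + q)) (t : Fin (r + 1))
  | free (i : Fin (e + 1)) (t : Fin (r + 1))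
  deriving DecidableEq

open Color

instance : Countable (Color e l q r) := by
  let f : Color e l q r → Fin (e + 2) ⊕ Fin l ⊕ Fin q ⊕ Fin q ⊕
      (Fin (l + q) × Fin (r + 1)) ⊕ (Fin (e + 1) × Fin (r + 1))
    | common i => .inl i
    | shared i => .inr (.inl i)
    | second i => .inr (.inr (.inl i))
    | third i => .inr (.inr (.inr (.inl i)))
    | meeting i t => .inr (.inr (.inr (.inr (.inl (i, t)))))
    | free i t => .inr (.inr (.inr (.inr (.inr (i, t)))))
  have hf : Function.Injective f := by
    rintro (_ | _ | _ | _ | _ | _) (_ | _ | _ | _ | _ | _) h <;> simp_all [f]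
  exact hf.countable

/-- The lists on the part of size `m`. -/
def left : Fin 3 ⊕ Fin (l + q) ⊕ Fin (e + 1) → Finset (Color e l q r)
  | .inl 0 => Finset.univ.image
      (Sum.elim common fun i => meeting i 0 : Fin (e + 2) ⊕ Fin (l + q) → _)
  | .inl 1 => Finset.univ.image
      (Sum.elim common (Sum.elim shared second) : Fin (e + 2) ⊕ Fin l ⊕ Fin q → _)
  | .inl 2 => Finset.univ.image
      (Sum.elim common (Sum.elim shared third) : Fin (e + 2) ⊕ Fin l ⊕ Fin q → _)
  | .inr (.inl i) => Finset.univ.image (meeting i)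
  | .inr (.inr i) => Finset.univ.image (free i)

/-- Choices of one color from each later list meeting the first list, at least one of which lies
in the first list. -/
abbrev Hit : Type := {g : Fin (l + q) → Fin (r + 1) // ∃ i, g i = 0}

/-- The index type of the lists on the other part. -/
abbrev RightIndex : Type :=
  (Fin (e + 2) × (Fin (l + q) → Fin (r + 1)) × (Fin (e + 1) → Fin (r + 1))) ⊕
  (Fin l × Hit l q r × (Fin (e + 1) → Fin (r + 1))) ⊕
  ((Fin q × Fin q) × Hit l q r × (Fin e → Fin (r + 1)))

/-- The lists on the other part. -/
def right : RightIndex e l q r → Finset (Color e l q r)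
  | .inl (c, g, h) => Finset.univ.image (Sum.elim (fun _ => common c)
      (Sum.elim (fun i => meeting i (g i)) fun i => free i (h i)) :
        Unit ⊕ Fin (l + q) ⊕ Fin (e + 1) → _)
  | .inr (.inl (s, g, h)) => Finset.univ.image (Sum.elim (fun _ => shared s)
      (Sum.elim (fun i => meeting i (g.1 i)) fun i => free i (h i)) :
        Unit ⊕ Fin (l + q) ⊕ Fin (e + 1) → _)
  | .inr (.inr ((x, y), g, h)) => Finset.univ.image
      (Sum.elim (Sum.elim (fun _ => second x) fun _ => third y)
        (Sum.elim (fun i => meeting i (g.1 i)) fun i => free i.castSucc (h i)) :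
        (Unit ⊕ Unit) ⊕ Fin (l + q) ⊕ Fin e → _)

theorem card_left (i) : (left e l q (l + q + e + 1) i).card = l + q + e + 2 := by
  rcases i with i | i | i
  · fin_cases i <;> simp only [left] <;> rw [Finset.card_image_of_injective]
    · simp; omega
    · rintro (_ | _) (_ | _) h <;> simp_all
    · simp; omega
    · rintro (_ | _ | _) (_ | _ | _) h <;> simp_all
    · simp; omega
    · rintro (_ | _ | _) (_ | _ | _) h <;> simp_all
  · simp only [left]
    rw [Finset.card_image_of_injective _ fun _ _ h => by simpa using h]
    simp
  · simp only [left]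
    rw [Finset.card_image_of_injective _ fun _ _ h => by simpa using h]
    simp

theorem card_right (b) : (right e l q r b).card = l + q + e + 2 := by
  rcases b with ⟨c, g, h⟩ | ⟨s, g, h⟩ | ⟨⟨x, y⟩, g, h⟩ <;> simp only [right] <;>
    rw [Finset.card_image_of_injective]
  · simp; omega
  · rintro (_ | _ | _) (_ | _ | _) h <;> simp_all
  · simp; omega
  · rintro (_ | _ | _) (_ | _ | _) h <;> simp_all
  · simp; omega
  · rintro ((_ | _) | _ | _) ((_ | _) | _ | _) h <;> simp_all

theorem exists_right_subset (a : Fin 3 ⊕ Fin (l + q) ⊕ Fin (e + 1) → Color e l q r)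
    (ha : ∀ i, a i ∈ left e l q r i) : ∃ b, ∀ x ∈ right e l q r b, ∃ i, a i = x := by
  have hg : ∀ i, ∃ t, meeting i t = a (.inr (.inl i)) := fun i => by
    simpa [left] using ha (.inr (.inl i))
  have hh : ∀ i, ∃ t, free i t = a (.inr (.inr i)) := fun i => by
    simpa [left] using ha (.inr (.inr i))
  choose g hg using hg
  choose h hh using hh
  have of_common : ∀ c j, common c = a j → ∃ b, ∀ x ∈ right e l q r b, ∃ i, a i = x := by
    refine fun c j hc => ⟨.inl (c, g, h), ?_⟩
    simp only [right, Finset.mem_image, Finset.mem_univ, true_and]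
    rintro _ ⟨_ | i | i, rfl⟩
    · exact ⟨j, hc.symm⟩
    · exact ⟨_, (hg i).symm⟩
    · exact ⟨_, (hh i).symm⟩
  have h0 : (∃ c, common c = a (.inl 0)) ∨ ∃ i, meeting i 0 = a (.inl 0) := by
    simpa [left] using ha (.inl 0)
  have h1 : (∃ c, common c = a (.inl 1)) ∨ (∃ i, shared i = a (.inl 1)) ∨
      ∃ i, second i = a (.inl 1) := by
    simpa [left] using ha (.inl 1)
  have h2 : (∃ c, common c = a (.inl 2)) ∨ (∃ i, shared i = a (.inl 2)) ∨
      ∃ i, third i = a (.inl 2) := by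
    simpa [left] using ha (.inl 2)
  rcases h0 with ⟨c, hc⟩ | ⟨i₀, hi₀⟩
  · exact of_common c _ hc
  let g' : Hit l q r := ⟨Function.update g i₀ 0, i₀, by simp⟩
  have hg' : ∀ i, ∃ j, a j = meeting i (g'.1 i) := fun i => by
    by_cases hi : i = i₀
    · subst hi
      exact ⟨.inl 0, by simp [g', ← hi₀]⟩
    · exact ⟨.inr (.inl i), by simp [g', hi, ← hg]⟩
  have of_shared : ∀ s j, shared s = a j → ∃ b, ∀ x ∈ right e l q r b, ∃ i, a i = x := by
    refine fun s j hs => ⟨.inr (.inl (s, g', h)), ?_⟩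
    simp only [right, Finset.mem_image, Finset.mem_univ, true_and]
    rintro _ ⟨_ | i | i, rfl⟩
    · exact ⟨j, hs.symm⟩
    · exact hg' i
    · exact ⟨_, (hh i).symm⟩
  rcases h1 with ⟨c, hc⟩ | ⟨s, hs⟩ | ⟨x, hx⟩
  · exact of_common c _ hc
  · exact of_shared s _ hs
  rcases h2 with ⟨c, hc⟩ | ⟨s, hs⟩ | ⟨y, hy⟩
  · exact of_common c _ hc
  · exact of_shared s _ hs
  refine ⟨.inr (.inr ((x, y), g', fun i => h i.castSucc)), ?_⟩
  simp only [right, Finset.mem_image, Finset.mem_univ, true_and]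
  rintro _ ⟨(_ | _) | i | i, rfl⟩
  · exact ⟨_, hx.symm⟩
  · exact ⟨_, hy.symm⟩
  · exact hg' i
  · exact ⟨_, (hh _).symm⟩

theorem card_rightIndex : Fintype.card (RightIndex e l q r) =
    (e + 2) * ((r + 1) ^ (l + q) * (r + 1) ^ (e + 1)) +
      (l * (((r + 1) ^ (l + q) - r ^ (l + q)) * (r + 1) ^ (e + 1)) +
        q * q * (((r + 1) ^ (l + q) - r ^ (l + q)) * (r + 1) ^ e)) := by
  simp only [Fintype.card_sum, Fintype.card_prod, card_exists_eq_zero, Fintype.card_fun,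
    Fintype.card_fin]

theorem nm_le_card : nm (l + q + e + 4) ≤ Fintype.card (RightIndex e l q (l + q + e + 1)) := by
  refine nm_le_of_not_choosable (r := l + q + e + 2) (by omega) ?_
  have h := not_choosable_of_forall_transversal (left e l q (l + q + e + 1))
    (right e l q (l + q + e + 1)) (card_left e l q) (card_right e l q _)
    (exists_right_subset e l q _)
  have hA : Fintype.card (Fin 3 ⊕ Fin (l + q) ⊕ Fin (e + 1)) = l + q + e + 2 + 2 := by
    simp; omega
  rwa [hA] at h

end ListConstruction

/-- For integers `k ≥ 2`, `m ≥ k + 4` and `0 ≤ l ≤ m - 2 - k`,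
`n_m ≤ k (m-2)^(m-3) + (m-2)^(k-2) [(m-2)^(m-2-k) - (m-3)^(m-2-k)]
  ((m-k-2)² + l² + 2 l k - l (m-2))`. -/
theorem nm_le_construction (m k l : ℕ) (hk : 2 ≤ k) (hm : k + 4 ≤ m)
    (hl : l ≤ m - 2 - k) :
    (nm m : ℝ) ≤ (k : ℝ) * ((m : ℝ) - 2) ^ (m - 3) +
      ((m : ℝ) - 2) ^ (k - 2) *
        (((m : ℝ) - 2) ^ (m - 2 - k) - ((m : ℝ) - 3) ^ (m - 2 - k)) *
        (((m : ℝ) - (k : ℝ) - 2) ^ 2 + (l : ℝ) ^ 2 + 2 * (l : ℝ) * (k : ℝ) -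
          (l : ℝ) * ((m : ℝ) - 2)) := by
  obtain ⟨e, rfl⟩ := Nat.exists_eq_add_of_le' hk
  obtain ⟨q, hq⟩ := Nat.exists_eq_add_of_le hl
  obtain rfl : m = l + q + e + 4 := by omega
  have h : (nm (l + q + e + 4) : ℝ) ≤ _ :=
    Nat.cast_le.mpr (ListConstruction.nm_le_card e l q)
  refine h.trans (le_of_eq ?_)
  rw [ListConstruction.card_rightIndex]
  have hpow : (l + q + e + 1) ^ (l + q) ≤ (l + q + e + 1 + 1) ^ (l + q) :=
    Nat.pow_le_pow_left (by omega) _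
  have e1 : l + q + e + 4 - 3 = l + q + (e + 1) := by omega
  have e2 : l + q + e + 4 - 2 - (e + 2) = l + q := by omega
  have e3 : ((l + q + e + 4 : ℕ) : ℝ) - 2 = l + q + e + 1 + 1 := by push_cast; ring
  have e4 : ((l + q + e + 4 : ℕ) : ℝ) - 3 = l + q + e + 1 := by push_cast; ring
  rw [e1, e2, e3, e4, Nat.add_sub_cancel]
  push_cast [Nat.cast_sub hpow]
  ring
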